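/- arXiv:2510.18655 — 3 statements merged into one kernel-verified Lean document; each statement's English description precedes it below -/
import Mathlib

section
/- There exist δ₀ > 0 and C > 0 with the following property. Let F(r) = λ'(s-r) - λ'(r), suppose s-r and r lie in (γ₀-δ₀, γ₀+δ₀), |F(r)| ≤ κ with 0 < κ ≤ δ₀, and suppose moreover κ ≥ ε₀·|s-2γ₀|^{3/2} for a fixed small ε₀ depending only on λ. Then |r - s/2| ≤ C·κ^{1/3} or r is within C·κ^{1/3} of a solution of x + π(x) = s. In particular, if κ ≥ |s - 2γ₀|^{3/2}, then the distance from r to the (stationary-phase) resonance set is at most C·κ/(κ^{2/3} + |s-2γ₀|). -/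
noncomputable def lam (x : ℝ) : ℝ := x * Real.sqrt ((2 + x ^ 2) / (1 + x ^ 2))

noncomputable def gamma0 : ℝ := Real.sqrt (1 + Real.sqrt 7)

open Filter Topology

theorem gamma0_pos : 0 < gamma0 := by
  unfold gamma0; positivity

theorem gamma0_sq : (gamma0 ^ 2 - 1) ^ 2 = 7 := by
  unfold gamma0
  rw [Real.sq_sqrt (by positivity), add_sub_cancel_left, Real.sq_sqrt (by norm_num)]

theorem one_lt_gamma0_sq : 1 < gamma0 ^ 2 := by
  unfold gamma0
  rw [Real.sq_sqrt (by positivity)]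
  have : 0 < √7 := by positivity
  linarith

theorem gamma0_bounds : 3 / 2 < gamma0 ∧ gamma0 < 5 / 2 := by
  have h := gamma0_sq
  have h1 := one_lt_gamma0_sq
  have h0 := gamma0_pos
  have h2 : 3 < gamma0 ^ 2 := by nlinarith
  have h3 : gamma0 ^ 2 < 4 := by nlinarith
  constructor <;> nlinarith

theorem deriv_lam (x : ℝ) : deriv lam x =
    ((1 + x ^ 2) ^ 2 + 1) / ((1 + x ^ 2) * (2 + x ^ 2)) * √((2 + x ^ 2) / (1 + x ^ 2)) := by
  have hq : 0 < (2 + x ^ 2) / (1 + x ^ 2) := by positivity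
  have hs := Real.sq_sqrt hq.le
  have hpos := Real.sqrt_pos.2 hq
  have hf : HasDerivAt (fun x : ℝ => (2 + x ^ 2) / (1 + x ^ 2))
      (((2 * x) * (1 + x ^ 2) - (2 + x ^ 2) * (2 * x)) / (1 + x ^ 2) ^ 2) x := by
    have hp : HasDerivAt (fun x : ℝ => x ^ 2) (2 * x) x := by simpa using hasDerivAt_pow 2 x
    exact (hp.const_add 2).div (hp.const_add 1) (by positivity)
  have h : HasDerivAt lam _ x := (hasDerivAt_id x).mul (hf.sqrt hq.ne')
  rw [h.deriv]
  set S := √((2 + x ^ 2) / (1 + x ^ 2))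
  have hS : S ^ 2 * (1 + x ^ 2) = 2 + x ^ 2 := by rw [hs]; field_simp
  simp only [id]
  field_simp
  linear_combination x ^ 2 * hS

theorem deriv_lam_pos (x : ℝ) : 0 < deriv lam x := by
  rw [deriv_lam]; positivity

theorem deriv_lam_sq (x : ℝ) : deriv lam x ^ 2 =
    ((1 + x ^ 2) ^ 2 + 1) ^ 2 / ((1 + x ^ 2) ^ 3 * (2 + x ^ 2)) := by
  rw [deriv_lam, mul_pow, Real.sq_sqrt (by positivity)]
  field_simp

theorem deriv_lam_le_two (x : ℝ) : deriv lam x ≤ 2 := by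
  refine (sq_le_sq₀ (deriv_lam_pos x).le (by norm_num)).1 ?_
  rw [deriv_lam_sq, div_le_iff₀ (by positivity)]
  have := sq_nonneg x
  generalize x ^ 2 = t at *
  have h2 := pow_nonneg this 2
  have h3 := pow_nonneg this 3
  have h4 := pow_nonneg this 4
  nlinarith

/-- Local existence of the reflection interchanging the two branches of `ψ ^ 2`
near a nondegenerate zero `c` of `ψ`. -/
theorem exists_analyticAt_reflection {ψ : ℝ → ℝ} {c ψ' : ℝ} (hψ : AnalyticAt ℝ ψ c)
    (hd : HasDerivAt ψ ψ' c) (h0 : ψ c = 0) (hne : ψ' ≠ 0) :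
    ∃ π : ℝ → ℝ, AnalyticAt ℝ π c ∧ π c = c ∧ deriv π c = -1 ∧
      ∀ᶠ x in 𝓝 c, ψ (π x) = -ψ x := by
  have hs : HasStrictDerivAt ψ ψ' c := hψ.contDiffAt.hasStrictDerivAt' hd one_ne_zero
  let ρ := hs.localInverse ψ ψ' c hne
  have hρc : ρ 0 = c := by
    have := (hs.eventually_left_inverse hne).self_of_nhds
    rwa [h0] at this
  have hρd : HasStrictDerivAt ρ ψ'⁻¹ 0 := h0 ▸ hs.to_localInverse hne
  have hρa : AnalyticAt ℝ ρ 0 := by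
    have hω : ContDiffAt ℝ ⊤ ψ c := hψ.contDiffAt
    have := hω.to_localInverse (hs.hasStrictFDerivAt_equiv hne).hasFDerivAt (by simp)
    rw [h0] at this
    exact this.analyticAt
  refine ⟨fun x => ρ (-ψ x), ?_, by simp [h0, hρc], ?_, ?_⟩
  · exact AnalyticAt.fun_comp (by simpa [h0] using hρa) hψ.neg
  · have h1 : HasDerivAt ρ ψ'⁻¹ (-ψ c) := by simpa [h0] using hρd.hasDerivAt
    have := (h1.comp c hd.neg).deriv
    simp only [Function.comp_def, Pi.neg_apply] at this
    rw [this]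
    field_simp
  · have ht : Tendsto (fun x => -ψ x) (𝓝 c) (𝓝 (ψ c)) := by
      simpa [h0] using hd.continuousAt.tendsto.neg
    exact ht.eventually (hs.eventually_right_inverse hne)

/-- With `p = (1 + x ^ 2)⁻¹` and `p₀` its value at `gamma0`, this is the analytic square root of
`(deriv lam) ^ 2 - (deriv lam gamma0) ^ 2` that changes sign at `gamma0`. -/
noncomputable def morseCoord (x : ℝ) : ℝ :=
  ((1 + x ^ 2)⁻¹ - (1 + gamma0 ^ 2)⁻¹) *
    √((((1 + x ^ 2)⁻¹) ^ 2 + 2 * (1 + gamma0 ^ 2)⁻¹ * (1 + x ^ 2)⁻¹ + 2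
      + 3 * ((1 + gamma0 ^ 2)⁻¹) ^ 2) / (1 + (1 + x ^ 2)⁻¹))

theorem morseCoord_gamma0 : morseCoord gamma0 = 0 := by simp [morseCoord]

theorem inv_gamma0_root :
    3 * ((1 + gamma0 ^ 2)⁻¹) ^ 2 + 4 * (1 + gamma0 ^ 2)⁻¹ - 1 = 0 := by
  have h := gamma0_sq
  field_simp
  linear_combination -h

theorem deriv_lam_sq_eq_morseCoord (x : ℝ) : deriv lam x ^ 2 =
    4 * (1 + gamma0 ^ 2)⁻¹ + 4 * ((1 + gamma0 ^ 2)⁻¹) ^ 3 + morseCoord x ^ 2 := by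
  have hr := inv_gamma0_root
  have hp0 : 0 < (1 + gamma0 ^ 2)⁻¹ := by positivity
  have hp : 0 < (1 + x ^ 2)⁻¹ := by positivity
  have h1 : deriv lam x ^ 2 = (1 + ((1 + x ^ 2)⁻¹) ^ 2) ^ 2 / (1 + (1 + x ^ 2)⁻¹) := by
    rw [deriv_lam_sq]; field_simp; ring
  rw [h1, morseCoord]
  generalize (1 + gamma0 ^ 2)⁻¹ = q at *
  generalize (1 + x ^ 2)⁻¹ = p at *
  rw [mul_pow, Real.sq_sqrt (by positivity)]
  field_simp
  linear_combination (-(q ^ 2 + 1)) * hr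

theorem analyticAt_morseCoord (x : ℝ) : AnalyticAt ℝ morseCoord x := by
  have hp : ContDiffAt ℝ ⊤ (fun x : ℝ => (1 + x ^ 2)⁻¹) x :=
    ContDiffAt.inv (by fun_prop) (by positivity)
  refine ContDiffAt.analyticAt ((hp.sub contDiffAt_const).mul (ContDiffAt.sqrt
    (ContDiffAt.div ?_ (contDiffAt_const.add hp) (by positivity)) (by positivity)))
  exact (((hp.pow 2).add (contDiffAt_const.mul hp)).add contDiffAt_const).add contDiffAt_const

theorem hasDerivAt_morseCoord : ∃ ψ' ≠ 0, HasDerivAt morseCoord ψ' gamma0 := by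
  have hg := gamma0_pos
  have hp : HasDerivAt (fun x : ℝ => (1 + x ^ 2)⁻¹ - (1 + gamma0 ^ 2)⁻¹)
      (-(2 * gamma0) / (1 + gamma0 ^ 2) ^ 2) gamma0 := by
    have h2 : HasDerivAt (fun x : ℝ => x ^ 2) (2 * gamma0) gamma0 := by
      simpa using hasDerivAt_pow 2 gamma0
    exact ((h2.const_add 1).inv (by positivity)).sub_const _
  have hs : DifferentiableAt ℝ (fun x : ℝ =>
      √((((1 + x ^ 2)⁻¹) ^ 2 + 2 * (1 + gamma0 ^ 2)⁻¹ * (1 + x ^ 2)⁻¹ + 2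
      + 3 * ((1 + gamma0 ^ 2)⁻¹) ^ 2) / (1 + (1 + x ^ 2)⁻¹))) gamma0 := by
    have hp := hp.differentiableAt.add_const ((1 + gamma0 ^ 2)⁻¹)
    simp only [sub_add_cancel] at hp
    refine DifferentiableAt.sqrt (DifferentiableAt.div ?_ (hp.const_add 1) (by positivity))
      (by positivity)
    exact (((hp.pow 2).add (hp.const_mul _)).add_const _).add_const _
  refine ⟨_, ?_, hp.mul hs.hasDerivAt⟩
  rw [sub_self, zero_mul, add_zero]
  have h1 : 0 < (2 * gamma0) / (1 + gamma0 ^ 2) ^ 2 := by positivity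
  rw [neg_div]
  refine mul_ne_zero (neg_ne_zero.2 h1.ne') (Real.sqrt_pos.2 ?_).ne'
  positivity

theorem exists_reflection : ∃ π : ℝ → ℝ, AnalyticAt ℝ π gamma0 ∧ π gamma0 = gamma0 ∧
    deriv π gamma0 = -1 ∧ ∀ᶠ x in 𝓝 gamma0, deriv lam (π x) = deriv lam x := by
  obtain ⟨ψ', hne, hd⟩ := hasDerivAt_morseCoord
  obtain ⟨π, ha, hfix, hderiv, hev⟩ :=
    exists_analyticAt_reflection (analyticAt_morseCoord gamma0) hd morseCoord_gamma0 hne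
  refine ⟨π, ha, hfix, hderiv, hev.mono fun x hx => ?_⟩
  rw [← sq_eq_sq₀ (deriv_lam_pos _).le (deriv_lam_pos _).le, deriv_lam_sq_eq_morseCoord,
    deriv_lam_sq_eq_morseCoord, hx, neg_sq]

/-- The symmetric quotient of the numerator of `(deriv lam y) ^ 2 - (deriv lam x) ^ 2` by `x ^ 2 - y ^ 2`,
in terms of `w = 1 + x ^ 2` and `v = 1 + y ^ 2`. -/
noncomputable def quotNum (w v : ℝ) : ℝ :=
  2 * (w + v) * (w * v) ^ 2 + (w + v) * (w ^ 2 + v ^ 2) - (w * v) ^ 3 + 2 * (w * v) ^ 2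
    + (w ^ 2 + w * v + v ^ 2)

theorem abs_mul_quotNum_le {x y : ℝ} (hx : x ∈ Set.Icc 1 3) (hy : y ∈ Set.Icc 1 3) :
    |(x - y) / 2| * |quotNum (1 + x ^ 2) (1 + y ^ 2)| ≤
      11000 ^ 2 * |deriv lam y - deriv lam x| := by
  have hxp := deriv_lam_pos x
  have hyp := deriv_lam_pos y
  have hD : ∀ z ∈ Set.Icc (1 : ℝ) 3, (1 + z ^ 2) ^ 3 * (2 + z ^ 2) ≤ 11000 := by
    rintro z ⟨h1, h3⟩
    calc (1 + z ^ 2) ^ 3 * (2 + z ^ 2) ≤ (1 + 3 ^ 2) ^ 3 * (2 + 3 ^ 2) := by gcongr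
      _ = 11000 := by norm_num
  have key : (deriv lam y - deriv lam x) * ((deriv lam y + deriv lam x) *
      (((1 + x ^ 2) ^ 3 * (2 + x ^ 2)) * ((1 + y ^ 2) ^ 3 * (2 + y ^ 2)))) =
      (x - y) / 2 * quotNum (1 + x ^ 2) (1 + y ^ 2) * (2 * (x + y)) := by
    have e : (deriv lam y - deriv lam x) * (deriv lam y + deriv lam x) =
      ((1 + y ^ 2) ^ 2 + 1) ^ 2 / ((1 + y ^ 2) ^ 3 * (2 + y ^ 2)) -
      ((1 + x ^ 2) ^ 2 + 1) ^ 2 / ((1 + x ^ 2) ^ 3 * (2 + x ^ 2)) := by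
      rw [← deriv_lam_sq, ← deriv_lam_sq]; ring
    rw [← mul_assoc, e]
    field_simp
    unfold quotNum
    ring
  have hpos : 0 ≤ |(x - y) / 2| * |quotNum (1 + x ^ 2) (1 + y ^ 2)| := by positivity
  have hle : (deriv lam y + deriv lam x) *
      (((1 + x ^ 2) ^ 3 * (2 + x ^ 2)) * ((1 + y ^ 2) ^ 3 * (2 + y ^ 2))) ≤
      (2 + 2) * (11000 * 11000) := by
    gcongr
    · exact deriv_lam_le_two y
    · exact deriv_lam_le_two x
    · exact hD x hx
    · exact hD y hy
  have hxy : 4 ≤ 2 * (x + y) := by linarith [hx.1, hy.1]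
  have habs := congrArg abs key
  rw [abs_mul, abs_mul ((x - y) / 2 * _), abs_mul ((x - y) / 2),
    abs_of_pos (by positivity : 0 < (deriv lam y + deriv lam x) *
      (((1 + x ^ 2) ^ 3 * (2 + x ^ 2)) * ((1 + y ^ 2) ^ 3 * (2 + y ^ 2)))),
    abs_of_pos (by linarith : 0 < 2 * (x + y))] at habs
  have h1 := mul_le_mul_of_nonneg_left hxy hpos
  have h2 := mul_le_mul_of_nonneg_left hle (abs_nonneg (deriv lam y - deriv lam x))
  linarith

/-- The cofactor of `d ^ 2` in the expansion of `quotNum` at the points `m + d` and `m - d`. -/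
noncomputable def cubicCoeff (m d : ℝ) : ℝ :=
  let a := 1 + m ^ 2 + d ^ 2
  let e := a ^ 2 - 4 * m ^ 2 * d ^ 2
  (2 - 2 * m ^ 2 - d ^ 2) * (a ^ 4 + a ^ 2) -
    4 * m ^ 2 * (4 * a * (e + a ^ 2) - 4 * a - (e ^ 2 + e * a ^ 2 + a ^ 4) + 2 * (e + a ^ 2) - 1)

theorem quotNum_eq (m d : ℝ) : quotNum (1 + (m + d) ^ 2) (1 + (m - d) ^ 2) =
    d ^ 2 * cubicCoeff m d - (m - gamma0) * ((m + gamma0) * (m ^ 2 + gamma0 ^ 2 - 2) *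
      ((1 + m ^ 2 + d ^ 2) ^ 4 + (1 + m ^ 2 + d ^ 2) ^ 2)) := by
  have h := gamma0_sq
  unfold quotNum cubicCoeff
  linear_combination (-((1 + m ^ 2 + d ^ 2) ^ 4 + (1 + m ^ 2 + d ^ 2) ^ 2)) * h

theorem exists_one_le_cubicCoeff :
    ∃ δ > 0, ∀ m d : ℝ, |m - gamma0| < δ → |d| < δ → 1 ≤ cubicCoeff m d := by
  have hc : Continuous fun z : ℝ × ℝ => cubicCoeff z.1 z.2 := by
    unfold cubicCoeff; fun_prop
  have hv : cubicCoeff gamma0 0 = 968 * gamma0 ^ 2 + 1600 := by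
    have h := gamma0_sq
    have h4 : gamma0 ^ 4 = 2 * gamma0 ^ 2 + 6 := by linear_combination h
    have h6 : gamma0 ^ 6 = 10 * gamma0 ^ 2 + 12 := by
      linear_combination (gamma0 ^ 2 + 2) * h4
    have h8 : gamma0 ^ 8 = 32 * gamma0 ^ 2 + 60 := by
      linear_combination gamma0 ^ 2 * h6 + 10 * h4
    have h10 : gamma0 ^ 10 = 124 * gamma0 ^ 2 + 192 := by
      linear_combination gamma0 ^ 2 * h8 + 32 * h4
    unfold cubicCoeff
    ring_nf
    rw [h4, h6, h8, h10]
    ring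
  have hlt : 1 < cubicCoeff gamma0 0 := by rw [hv]; nlinarith [sq_nonneg gamma0]
  obtain ⟨δ, hδ, h⟩ := Metric.eventually_nhds_iff.1
    ((hc.tendsto (gamma0, 0)).eventually (lt_mem_nhds hlt))
  refine ⟨δ, hδ, fun m d hm hd => (@h (m, d) ?_).le⟩
  rw [Prod.dist_eq, Real.dist_eq, Real.dist_eq]
  simpa using ⟨hm, hd⟩

theorem le_mul_of_cube_le {D k K A : ℝ} (hk : 0 ≤ k) (hK : 0 ≤ K) (hA : 0 ≤ A)
    (h : D ^ 3 ≤ K * k ^ 3 + A * k ^ 2 * D) : D ≤ (1 + K + A) * k := by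
  by_contra! hlt
  have hk' : k ≤ D := by nlinarith [mul_nonneg hK hk, mul_nonneg hA hk]
  have hD : 0 < D := lt_of_le_of_lt (by positivity) hlt
  have h1 : K * k ^ 3 ≤ K * k ^ 2 * D := by
    have := mul_le_mul_of_nonneg_left hk' (mul_nonneg hK (sq_nonneg k))
    linarith
  have h2 : D ^ 2 ≤ (K + A) * k ^ 2 := by
    have : D ^ 2 * D ≤ (K + A) * k ^ 2 * D := by linarith
    exact le_of_mul_le_mul_right this hD
  have h3 : ((1 + K + A) * k) ^ 2 < D ^ 2 := by gcongr
  nlinarith [mul_nonneg (by positivity : 0 ≤ 1 + K + A + (K + A) ^ 2) (sq_nonneg k)]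

theorem cube_half_sub_le {x y : ℝ} (hx : x ∈ Set.Icc 1 3) (hy : y ∈ Set.Icc 1 3)
    (hc : 1 ≤ cubicCoeff ((x + y) / 2) ((x - y) / 2)) :
    |(x - y) / 2| ^ 3 ≤ 11000 ^ 2 * |deriv lam y - deriv lam x| +
      484800 * |x + y - 2 * gamma0| * |(x - y) / 2| := by
  have h := abs_mul_quotNum_le hx hy
  have hb := gamma0_bounds
  obtain ⟨hx1, hx3⟩ := hx
  obtain ⟨hy1, hy3⟩ := hy
  have hN := quotNum_eq ((x + y) / 2) ((x - y) / 2)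
  have hx' : (x + y) / 2 + (x - y) / 2 = x := by ring
  have hy' : (x + y) / 2 - (x - y) / 2 = y := by ring
  have ha : 1 + ((x + y) / 2) ^ 2 + ((x - y) / 2) ^ 2 ≤ 10 := by nlinarith
  rw [hx', hy'] at hN
  have hm1 : 1 ≤ (x + y) / 2 := by linarith
  have hm3 : (x + y) / 2 ≤ 3 := by linarith
  have hs : |x + y - 2 * gamma0| = 2 * |(x + y) / 2 - gamma0| := by
    rw [← abs_two, ← abs_mul, abs_two]; ring_nf
  rw [hs]
  generalize (x + y) / 2 = m at *
  generalize (x - y) / 2 = d at *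
  generalize quotNum (1 + x ^ 2) (1 + y ^ 2) = N at *
  have hB : |(m + gamma0) * (m ^ 2 + gamma0 ^ 2 - 2) *
      ((1 + m ^ 2 + d ^ 2) ^ 4 + (1 + m ^ 2 + d ^ 2) ^ 2)| ≤ 6 * 16 * (10 ^ 4 + 10 ^ 2) := by
    have h1 : 0 ≤ m ^ 2 + gamma0 ^ 2 - 2 := by nlinarith
    have h2 : m ^ 2 + gamma0 ^ 2 - 2 ≤ 16 := by nlinarith
    have h3 : m + gamma0 ≤ 6 := by linarith
    have h4 : 0 ≤ m + gamma0 := by linarith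
    rw [abs_of_nonneg (by positivity)]
    gcongr
  have h5 : d ^ 2 ≤ |N| + |m - gamma0| * (6 * 16 * (10 ^ 4 + 10 ^ 2)) := by
    calc d ^ 2 ≤ d ^ 2 * cubicCoeff m d := le_mul_of_one_le_right (sq_nonneg d) hc
      _ = N + (m - gamma0) * ((m + gamma0) * (m ^ 2 + gamma0 ^ 2 - 2) *
        ((1 + m ^ 2 + d ^ 2) ^ 4 + (1 + m ^ 2 + d ^ 2) ^ 2)) := by rw [hN]; ring
      _ ≤ _ := by
        refine add_le_add (le_abs_self _) ((le_abs_self _).trans ?_)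
        rw [abs_mul]
        gcongr
  have h6 := mul_le_mul_of_nonneg_left h5 (abs_nonneg d)
  have h7 : |d| ^ 3 = |d| * d ^ 2 := by rw [← sq_abs d]; ring
  rw [h7]
  linarith

theorem stmt_14 : ∃ ε₀ δ₀ C : ℝ, 0 < ε₀ ∧ 0 < δ₀ ∧ 0 < C ∧ ∃ pf : ℝ → ℝ,
    ContDiffOn ℝ (⊤ : ℕ∞) pf (Set.Ioo (gamma0 - δ₀) (gamma0 + δ₀)) ∧
    pf gamma0 = gamma0 ∧ deriv pf gamma0 = -1 ∧
    (∀ x ∈ Set.Ioo (gamma0 - δ₀) (gamma0 + δ₀), deriv lam (pf x) = deriv lam x) ∧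
    ∀ s r κ : ℝ,
      s - r ∈ Set.Ioo (gamma0 - δ₀) (gamma0 + δ₀) →
      r ∈ Set.Ioo (gamma0 - δ₀) (gamma0 + δ₀) →
      0 < κ → κ ≤ δ₀ →
      |deriv lam (s - r) - deriv lam r| ≤ κ →
      ε₀ * |s - 2 * gamma0| ^ ((3 : ℝ) / 2) ≤ κ →
      ((|r - s / 2| ≤ C * κ ^ ((1 : ℝ) / 3) ∨
          ∃ x ∈ Set.Ioo (gamma0 - δ₀) (gamma0 + δ₀),
            x + pf x = s ∧ |r - x| ≤ C * κ ^ ((1 : ℝ) / 3)) ∧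
        (|s - 2 * gamma0| ^ ((3 : ℝ) / 2) ≤ κ →
          |r - s / 2| ≤ C * κ / (κ ^ ((2 : ℝ) / 3) + |s - 2 * gamma0|) ∨
          ∃ x ∈ Set.Ioo (gamma0 - δ₀) (gamma0 + δ₀),
            x + pf x = s ∧ |r - x| ≤ C * κ / (κ ^ ((2 : ℝ) / 3) + |s - 2 * gamma0|))) := by
  obtain ⟨pf, ha, hfix, hderiv, hev⟩ := exists_reflection
  obtain ⟨δ₁, hδ₁, h₁⟩ := Metric.eventually_nhds_iff.1 (hev.and ha.eventually_analyticAt)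
  obtain ⟨δ₂, hδ₂, h₂⟩ := exists_one_le_cubicCoeff
  have hδ : 0 < min (min δ₁ δ₂) (1 / 2) := by positivity
  have hle₁ : min (min δ₁ δ₂) (1 / 2) ≤ δ₁ := (min_le_left _ _).trans (min_le_left _ _)
  have hle₂ : min (min δ₁ δ₂) (1 / 2) ≤ δ₂ := (min_le_left _ _).trans (min_le_right _ _)
  have hle₃ : min (min δ₁ δ₂) (1 / 2) ≤ 1 / 2 := min_le_right _ _
  generalize min (min δ₁ δ₂) (1 / 2) = δ₀ at *
  have hnear : ∀ x ∈ Set.Ioo (gamma0 - δ₀) (gamma0 + δ₀), dist x gamma0 < δ₁ := by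
    rintro x ⟨hl, hr⟩
    rw [Real.dist_eq, abs_lt]
    constructor <;> linarith
  have hb := gamma0_bounds
  have hIcc : ∀ x ∈ Set.Ioo (gamma0 - δ₀) (gamma0 + δ₀), x ∈ Set.Icc (1 : ℝ) 3 := by
    rintro x ⟨hl, hr⟩
    constructor <;> linarith
  set C₁ : ℝ := 1 + 11000 ^ 2 + 484800 with hC₁
  refine ⟨1, δ₀, 2 * C₁, one_pos, hδ, by positivity, pf,
    fun x hx => (h₁ (hnear x hx)).2.contDiffAt.contDiffWithinAt, hfix, hderiv,
    fun x hx => (h₁ (hnear x hx)).1, ?_⟩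
  intro s r κ hsr hr hκ _ hF hσ
  rw [one_mul] at hσ
  have hk : 0 < κ ^ ((1 : ℝ) / 3) := by positivity
  have hk3 : (κ ^ ((1 : ℝ) / 3)) ^ 3 = κ := by
    rw [← Real.rpow_natCast, ← Real.rpow_mul hκ.le]; norm_num
  have hk2 : κ ^ ((2 : ℝ) / 3) = (κ ^ ((1 : ℝ) / 3)) ^ 2 := by
    rw [← Real.rpow_natCast, ← Real.rpow_mul hκ.le]; norm_num
  have hσ' : |s - 2 * gamma0| ≤ (κ ^ ((1 : ℝ) / 3)) ^ 2 := by
    have := Real.rpow_le_rpow (by positivity) hσ (by norm_num : (0 : ℝ) ≤ 2 / 3)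
    rw [← Real.rpow_mul (abs_nonneg _), hk2] at this
    norm_num at this ⊢
    exact this
  have hD : |r - s / 2| ≤ C₁ * κ ^ ((1 : ℝ) / 3) := by
    have e1 : r + (s - r) = s := by ring
    have e2 : (r - (s - r)) / 2 = r - s / 2 := by ring
    have hc := h₂ (s / 2) (r - s / 2)
      (by rw [abs_lt]; constructor <;> linarith [hsr.1, hsr.2, hr.1, hr.2])
      (by rw [abs_lt]; constructor <;> linarith [hsr.1, hsr.2, hr.1, hr.2])
    have := cube_half_sub_le (hIcc r hr) (hIcc _ hsr) (by rwa [e1, e2])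
    rw [e1, e2] at this
    refine le_mul_of_cube_le hk.le (by norm_num) (by norm_num) (this.trans ?_)
    rw [hk3]
    gcongr
  generalize κ ^ ((1 : ℝ) / 3) = k at *
  have hC : 0 < C₁ := by positivity
  refine ⟨Or.inl (hD.trans ?_), fun _ => Or.inl (hD.trans ?_)⟩
  · nlinarith [mul_pos hC hk]
  · rw [hk2, ← hk3, le_div_iff₀ (by positivity)]
    calc C₁ * k * (k ^ 2 + |s - 2 * gamma0|) ≤ C₁ * k * (k ^ 2 + k ^ 2) := by gcongr
      _ = 2 * C₁ * k ^ 3 := by ring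
end

section
/- Let N > M ≥ 0 be integers and θ = M/N. There is a constant C (depending on M, N) such that for every Schwartz function f on ℝ², ‖Ω^M f‖_{L^∞} ≤ C·‖f‖_{L^∞}^{1-θ} · ‖⟨D⟩²Ω^{[0,N]} f‖_{L²}^{θ}, where Ω = x₁∂_{x₂} - x₂∂_{x₁}, ‖⟨D⟩²Ω^{[0,N]}f‖_{L²} = max_{0≤a≤N} ‖⟨D⟩²Ω^a f‖_{L²}, and ⟨D⟩² is the Fourier multiplier with symbol 1+|ξ|². -/
open MeasureTheory
open scoped FourierTransform

noncomputable def Omega (f : EuclideanSpace ℝ (Fin 2) → ℂ) :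
    EuclideanSpace ℝ (Fin 2) → ℂ :=
  fun x => x 0 • fderiv ℝ f x (EuclideanSpace.single 1 1) -
    x 1 • fderiv ℝ f x (EuclideanSpace.single 0 1)

noncomputable def JD (s : ℝ) (g : EuclideanSpace ℝ (Fin 2) → ℂ) :
    EuclideanSpace ℝ (Fin 2) → ℂ :=
  𝓕⁻ (fun ξ => (((1 + ‖ξ‖ ^ 2) ^ (s / 2) : ℝ) : ℂ) * 𝓕 g ξ)

open SchwartzMap LineDeriv in
/-- The rotational vector field acting on Schwartz functions. -/
noncomputable def omegaSchwartz (f : SchwartzMap (EuclideanSpace ℝ (Fin 2)) ℂ) :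
    SchwartzMap (EuclideanSpace ℝ (Fin 2)) ℂ :=
  smulLeftCLM ℂ (fun x : EuclideanSpace ℝ (Fin 2) => x 0)
      (∂_{EuclideanSpace.single (1 : Fin 2) (1 : ℝ)} f) -
    smulLeftCLM ℂ (fun x : EuclideanSpace ℝ (Fin 2) => x 1)
      (∂_{EuclideanSpace.single (0 : Fin 2) (1 : ℝ)} f)

theorem coe_omegaSchwartz (f : SchwartzMap (EuclideanSpace ℝ (Fin 2)) ℂ) :
    ⇑(omegaSchwartz f) = Omega f := by
  have hcoord (i : Fin 2) :
      (fun x : EuclideanSpace ℝ (Fin 2) => x i).HasTemperateGrowth :=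
    (EuclideanSpace.proj i : EuclideanSpace ℝ (Fin 2) →L[ℝ] ℝ).hasTemperateGrowth
  ext x
  rw [omegaSchwartz, _root_.sub_apply,
    SchwartzMap.smulLeftCLM_apply_apply (hcoord 0), SchwartzMap.smulLeftCLM_apply_apply (hcoord 1),
    SchwartzMap.lineDerivOp_apply_eq_fderiv, SchwartzMap.lineDerivOp_apply_eq_fderiv, Omega]

theorem coe_iterate_omegaSchwartz (f : SchwartzMap (EuclideanSpace ℝ (Fin 2)) ℂ) (n : ℕ) :
    ⇑(omegaSchwartz^[n] f) = Omega^[n] f :=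
  (Function.Semiconj.iterate_right coe_omegaSchwartz n) f

/-- The orbit of `x` under rotations about the origin. -/
noncomputable def rotationOrbit (x : EuclideanSpace ℝ (Fin 2)) (t : ℝ) :
    EuclideanSpace ℝ (Fin 2) :=
  Real.cos t • x + Real.sin t • !₂[-x 1, x 0]

theorem hasDerivAt_comp_rotationOrbit (f : SchwartzMap (EuclideanSpace ℝ (Fin 2)) ℂ)
    (x : EuclideanSpace ℝ (Fin 2)) (t : ℝ) :
    HasDerivAt (fun s => f (rotationOrbit x s)) (omegaSchwartz f (rotationOrbit x t)) t := by
  have horbit : HasDerivAt (rotationOrbit x)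
      ((-Real.sin t) • x + Real.cos t • !₂[-x 1, x 0]) t :=
    ((Real.hasDerivAt_cos t).smul_const x).add ((Real.hasDerivAt_sin t).smul_const _)
  have h := (f.differentiableAt (x := rotationOrbit x t)).hasFDerivAt.comp_hasDerivAt t horbit
  refine h.congr_deriv ?_
  symm
  rw [coe_omegaSchwartz, Omega, ← map_smul, ← map_smul, ← map_sub]
  congr 1
  ext i
  fin_cases i <;> simp [rotationOrbit]
  ring

/-- Landau's inequality: a bound on a derivative at `0` from bounds on the function and on its
second derivative. -/
theorem norm_deriv_sq_le_of_bounds {E : Type*} [NormedAddCommGroup E] [NormedSpace ℝ E]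
    {F dF ddF : ℝ → E} {A B : ℝ} (hF : ∀ t, HasDerivAt F (dF t) t)
    (hdF : ∀ t, HasDerivAt dF (ddF t) t) (hA : ∀ t, ‖F t‖ ≤ A) (hB : ∀ t, ‖ddF t‖ ≤ B) :
    ‖dF 0‖ ^ 2 ≤ 8 * (A * B) := by
  have hA0 : 0 ≤ A := (norm_nonneg _).trans (hA 0)
  have hB0 : 0 ≤ B := (norm_nonneg _).trans (hB 0)
  have key (h : ℝ) : 0 ≤ B * (h * h) + (-‖dF 0‖) * h + 2 * A := by
    rcases le_or_gt h 0 with hh | hh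
    · nlinarith [mul_nonneg hB0 (mul_self_nonneg h),
        mul_nonneg (norm_nonneg (dF 0)) (neg_nonneg.2 hh)]
    have h1 (s : ℝ) (hs : s ∈ Set.Icc 0 h) : ‖dF s - dF 0‖ ≤ B * s := by
      simpa using norm_image_sub_le_of_norm_deriv_le_segment'
        (fun y _ => (hdF y).hasDerivWithinAt) (fun y _ => hB y) s hs
    have h2 : ‖(F h - h • dF 0) - (F 0 - (0 : ℝ) • dF 0)‖ ≤ B * h * (h - 0) :=
      norm_image_sub_le_of_norm_deriv_le_segment' (f := fun s => F s - s • dF 0)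
        (f' := fun s => dF s - dF 0) (a := 0) (b := h)
        (fun y _ => by
          simpa using! ((hF y).sub ((hasDerivAt_id y).smul_const (dF 0))).hasDerivWithinAt)
        (fun y hy => (h1 y ⟨hy.1, hy.2.le⟩).trans (mul_le_mul_of_nonneg_left hy.2.le hB0))
        h ⟨hh.le, le_rfl⟩
    have h3 : ‖h • dF 0‖ ≤ ‖F h‖ + ‖F 0‖ + ‖(F h - h • dF 0) - (F 0 - (0 : ℝ) • dF 0)‖ := by
      calc ‖h • dF 0‖ = ‖F h - F 0 - ((F h - h • dF 0) - (F 0 - (0 : ℝ) • dF 0))‖ := by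
            congr 1; simp
        _ ≤ _ := (norm_sub_le _ _).trans (add_le_add_left (norm_sub_le _ _) _)
    rw [norm_smul, Real.norm_of_nonneg hh.le] at h3
    linarith [hA h, hA 0]
  have := discrim_le_zero key
  rw [discrim] at this
  nlinarith

theorem norm_le_toReal_eLpNorm_top (f : SchwartzMap (EuclideanSpace ℝ (Fin 2)) ℂ)
    (x : EuclideanSpace ℝ (Fin 2)) : ‖f x‖ ≤ (eLpNorm f ⊤ volume).toReal := by
  have hfin : eLpNorm f ⊤ volume ≠ ⊤ := (f.eLpNorm_lt_top ⊤ volume).ne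
  have hopen : IsOpen {y | (eLpNorm f ⊤ volume).toReal < ‖f y‖} :=
    isOpen_lt continuous_const f.continuous.norm
  have hnull : volume {y | (eLpNorm f ⊤ volume).toReal < ‖f y‖} = 0 := by
    have h := enorm_ae_le_eLpNormEssSup f volume
    rw [← eLpNorm_exponent_top] at h
    refine measure_mono_null (fun y hy => ?_) h
    simp only [Set.mem_ofPred_eq, Set.mem_compl_iff, not_le] at hy ⊢
    rwa [← ofReal_norm, ENNReal.lt_ofReal_iff_toReal_lt hfin]
  have := hopen.measure_eq_zero_iff volume |>.1 hnull
  by_contra! h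
  exact (Set.eq_empty_iff_forall_notMem.1 this x) h

theorem toReal_eLpNorm_omegaSchwartz_sq_le (f : SchwartzMap (EuclideanSpace ℝ (Fin 2)) ℂ) :
    (eLpNorm (omegaSchwartz f) ⊤ volume).toReal ^ 2 ≤
      9 * ((eLpNorm f ⊤ volume).toReal *
        (eLpNorm (omegaSchwartz (omegaSchwartz f)) ⊤ volume).toReal) := by
  have hpt (x : EuclideanSpace ℝ (Fin 2)) : ‖omegaSchwartz f x‖ ≤
      √(9 * ((eLpNorm f ⊤ volume).toReal *
        (eLpNorm (omegaSchwartz (omegaSchwartz f)) ⊤ volume).toReal)) := by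
    have h := norm_deriv_sq_le_of_bounds (hasDerivAt_comp_rotationOrbit f x)
      (hasDerivAt_comp_rotationOrbit (omegaSchwartz f) x)
      (fun t => norm_le_toReal_eLpNorm_top f _) (fun t => norm_le_toReal_eLpNorm_top _ _)
    rw [show rotationOrbit x 0 = x by simp [rotationOrbit]] at h
    exact Real.le_sqrt_of_sq_le (h.trans (by gcongr; norm_num))
  have hsup : (eLpNorm (omegaSchwartz f) ⊤ volume).toReal ≤
      √(9 * ((eLpNorm f ⊤ volume).toReal *
        (eLpNorm (omegaSchwartz (omegaSchwartz f)) ⊤ volume).toReal)) := by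
    refine ENNReal.toReal_le_of_le_ofReal (Real.sqrt_nonneg _) ?_
    rw [eLpNorm_exponent_top]
    exact eLpNormEssSup_le_of_ae_bound (.of_forall hpt)
  exact (Real.le_sqrt ENNReal.toReal_nonneg (by positivity)).1 hsup

/-- Interpolation for log-convex sequences. -/
theorem pow_le_pow_mul_pow_of_sq_le_mul {b : ℕ → ℝ} (hb : ∀ k, 0 ≤ b k)
    (hconv : ∀ k, b (k + 1) ^ 2 ≤ b k * b (k + 2)) {M N : ℕ} (hMN : M ≤ N) :
    b M ^ N ≤ b 0 ^ (N - M) * b N ^ M := by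
  have hstep (k : ℕ) : b k ^ (k + 1) ≤ b 0 * b (k + 1) ^ k := by
    induction k with
    | zero => simp
    | succ k ih =>
      rcases (hb (k + 1)).eq_or_lt with h0 | hpos
      · rw [← h0, zero_pow (by omega)]
        exact mul_nonneg (hb 0) (pow_nonneg (hb _) _)
      refine le_of_mul_le_mul_right ?_ (pow_pos hpos k)
      calc b (k + 1) ^ (k + 1 + 1) * b (k + 1) ^ k
          = (b (k + 1) ^ 2) ^ (k + 1) := by ring
        _ ≤ (b k * b (k + 2)) ^ (k + 1) := by gcongr; exact hconv k
        _ = b k ^ (k + 1) * b (k + 2) ^ (k + 1) := mul_pow _ _ _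
        _ ≤ (b 0 * b (k + 1) ^ k) * b (k + 2) ^ (k + 1) :=
            mul_le_mul_of_nonneg_right ih (pow_nonneg (hb _) _)
        _ = b 0 * b (k + 1 + 1) ^ (k + 1) * b (k + 1) ^ k := by ring
  induction N, hMN using Nat.le_induction with
  | base => simp
  | succ N hMN ih =>
    rcases N.eq_zero_or_pos with rfl | hN
    · obtain rfl : M = 0 := by omega
      simp
    refine le_of_pow_le_pow_left₀ hN.ne' (mul_nonneg (pow_nonneg (hb _) _) (pow_nonneg (hb _) _)) ?_
    obtain ⟨d, rfl⟩ := Nat.exists_eq_add_of_le hMN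
    have e1 : M + d - M = d := by omega
    have e2 : M + d + 1 - M = d + 1 := by omega
    rw [e1] at ih
    rw [e2]
    calc (b M ^ (M + d + 1)) ^ (M + d) = (b M ^ (M + d)) ^ (M + d + 1) := by
          rw [← pow_mul, ← pow_mul, mul_comm]
      _ ≤ (b 0 ^ d * b (M + d) ^ M) ^ (M + d + 1) :=
          pow_le_pow_left₀ (pow_nonneg (hb _) _) ih _
      _ = b 0 ^ (d * (M + d + 1)) * (b (M + d) ^ (M + d + 1)) ^ M := by
          rw [mul_pow, ← pow_mul, ← pow_mul, ← pow_mul, mul_comm M]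
      _ ≤ b 0 ^ (d * (M + d + 1)) * (b 0 * b (M + d + 1) ^ (M + d)) ^ M :=
          mul_le_mul_of_nonneg_left
            (pow_le_pow_left₀ (pow_nonneg (hb _) _) (hstep _) _) (pow_nonneg (hb _) _)
      _ = (b 0 ^ (d + 1) * b (M + d + 1) ^ M) ^ (M + d) := by
          rw [mul_pow, mul_pow, ← pow_mul, ← pow_mul, ← pow_mul, ← mul_assoc, ← pow_add]
          congr 2 <;> ring

theorem pow_le_of_sq_le_nine_mul {a : ℕ → ℝ} (ha : ∀ k, 0 ≤ a k)
    (hconv : ∀ k, a (k + 1) ^ 2 ≤ 9 * (a k * a (k + 2))) {M N : ℕ} (hMN : M ≤ N) :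
    a M ^ N ≤ a 0 ^ (N - M) * (3 ^ N ^ 2 * a N) ^ M := by
  have h := pow_le_pow_mul_pow_of_sq_le_mul (b := fun k => 3 ^ k ^ 2 * a k)
    (fun k => mul_nonneg (by positivity) (ha k)) (fun k => ?_) hMN
  · refine le_trans (pow_le_pow_left₀ (ha M) ?_ N) (h.trans_eq (by simp))
    exact le_mul_of_one_le_left (ha M) (one_le_pow₀ (by norm_num))
  · calc (3 ^ (k + 1) ^ 2 * a (k + 1)) ^ 2 = (3 ^ (k + 1) ^ 2) ^ 2 * a (k + 1) ^ 2 := mul_pow _ _ _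
      _ ≤ (3 ^ (k + 1) ^ 2) ^ 2 * (9 * (a k * a (k + 2))) :=
          mul_le_mul_of_nonneg_left (hconv k) (by positivity)
      _ = 3 ^ k ^ 2 * a k * (3 ^ (k + 2) ^ 2 * a (k + 2)) := by
          have : (3 : ℝ) ^ k ^ 2 * 3 ^ (k + 2) ^ 2 = (3 ^ (k + 1) ^ 2) ^ 2 * 9 := by
            rw [show (9 : ℝ) = 3 ^ 2 by norm_num, ← pow_mul, ← pow_add, ← pow_add]
            congr 1
            ring
          linear_combination -(a k * a (k + 2)) * this

theorem memLp_one_add_norm_sq_inv :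
    MemLp (fun ξ : EuclideanSpace ℝ (Fin 2) => (1 + ‖ξ‖ ^ 2)⁻¹) 2 volume := by
  have hcont : Continuous fun ξ : EuclideanSpace ℝ (Fin 2) => (1 + ‖ξ‖ ^ 2)⁻¹ :=
    Continuous.inv₀ (by fun_prop) fun ξ => by positivity
  rw [memLp_two_iff_integrable_sq hcont.aestronglyMeasurable]
  have h := integrable_rpow_neg_one_add_norm_sq (E := EuclideanSpace ℝ (Fin 2))
    (μ := volume) (r := 4) (by simp; norm_num)
  refine h.congr (.of_forall fun ξ => ?_)
  have hpos : (0 : ℝ) ≤ 1 + ‖ξ‖ ^ 2 := by positivity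
  change (1 + ‖ξ‖ ^ 2) ^ (-4 / 2 : ℝ) = ((1 + ‖ξ‖ ^ 2)⁻¹) ^ 2
  rw [show (-4 / 2 : ℝ) = -(2 : ℕ) by norm_num, Real.rpow_neg hpos, Real.rpow_natCast, inv_pow]

theorem SchwartzMap.eLpNorm_fourierInv_eq {V H : Type*} [NormedAddCommGroup V]
    [InnerProductSpace ℝ V] [FiniteDimensional ℝ V] [MeasurableSpace V] [BorelSpace V]
    [NormedAddCommGroup H] [InnerProductSpace ℂ H] [CompleteSpace H] (h : SchwartzMap V H) :
    eLpNorm (𝓕⁻ (h : V → H)) 2 volume = eLpNorm h 2 volume := by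
  have hnorm := (𝓕⁻ h).norm_fourier_toL2_eq
  rw [FourierTransform.fourier_fourierInv_eq, SchwartzMap.norm_toLp, SchwartzMap.norm_toLp,
    ENNReal.toReal_eq_toReal_iff' (h.eLpNorm_lt_top 2 volume).ne
      ((𝓕⁻ h).eLpNorm_lt_top 2 volume).ne] at hnorm
  rw [hnorm, SchwartzMap.fourierInv_coe]

/-- The embedding of `H²` into `L^∞` in two dimensions. -/
theorem eLpNorm_top_le_mul_eLpNorm_JD (g : SchwartzMap (EuclideanSpace ℝ (Fin 2)) ℂ) :
    eLpNorm g ⊤ volume ≤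
      eLpNorm (fun ξ : EuclideanSpace ℝ (Fin 2) => (1 + ‖ξ‖ ^ 2)⁻¹) 2 volume *
        eLpNorm (JD 2 g) 2 volume := by
  have hgrowth : (fun ξ : EuclideanSpace ℝ (Fin 2) => 1 + ‖ξ‖ ^ 2).HasTemperateGrowth := by
    fun_prop
  set h : SchwartzMap (EuclideanSpace ℝ (Fin 2)) ℂ :=
    SchwartzMap.smulLeftCLM ℂ (fun ξ : EuclideanSpace ℝ (Fin 2) => 1 + ‖ξ‖ ^ 2) (𝓕 g)
  have happ (ξ : EuclideanSpace ℝ (Fin 2)) : h ξ = (1 + ‖ξ‖ ^ 2) • 𝓕 g ξ :=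
    SchwartzMap.smulLeftCLM_apply_apply hgrowth _ ξ
  have hJD : JD 2 g = 𝓕⁻ (h : EuclideanSpace ℝ (Fin 2) → ℂ) := by
    rw [JD]
    congr 1
    ext ξ
    rw [happ, Complex.real_smul, SchwartzMap.fourier_coe]
    norm_num
  have hmul : ⇑(𝓕 g : SchwartzMap (EuclideanSpace ℝ (Fin 2)) ℂ) =
      (fun ξ : EuclideanSpace ℝ (Fin 2) => (1 + ‖ξ‖ ^ 2)⁻¹) • ⇑h := by
    ext ξ
    have : (1 + ‖ξ‖ ^ 2 : ℝ) ≠ 0 := by positivity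
    rw [Pi.smul_apply', happ, inv_smul_smul₀ this]
  have hL1 : eLpNorm g ⊤ volume ≤
      eLpNorm (𝓕 g : SchwartzMap (EuclideanSpace ℝ (Fin 2)) ℂ) 1 volume := by
    rw [eLpNorm_exponent_top, eLpNorm_one_eq_lintegral_enorm]
    refine eLpNormEssSup_le_of_ae_enorm_bound (.of_forall fun x => ?_)
    have hinv : g = 𝓕⁻ (𝓕 g : SchwartzMap (EuclideanSpace ℝ (Fin 2)) ℂ) :=
      (FourierTransform.fourierInv_fourier_eq g).symm
    conv_lhs => rw [hinv, SchwartzMap.fourierInv_coe, Real.fourierInv_eq]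
    refine (enorm_integral_le_lintegral_enorm _).trans_eq ?_
    simp only [← ofReal_norm, Circle.norm_smul]
  refine hL1.trans ?_
  rw [hJD, SchwartzMap.eLpNorm_fourierInv_eq, hmul]
  exact eLpNorm_smul_le_mul_eLpNorm h.continuous.aestronglyMeasurable
    memLp_one_add_norm_sq_inv.aestronglyMeasurable

theorem stmt_18 (M N : ℕ) (hMN : M < N) :
    ∃ C : ℝ, 0 < C ∧ ∀ f : SchwartzMap (EuclideanSpace ℝ (Fin 2)) ℂ,
      eLpNorm (Omega^[M] ⇑f) ⊤ volume ≤
        ENNReal.ofReal C * (eLpNorm (⇑f) ⊤ volume) ^ (1 - (M : ℝ) / N) *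
          ((Finset.range (N + 1)).sup fun a =>
              eLpNorm (JD 2 (Omega^[a] ⇑f)) 2 volume) ^ ((M : ℝ) / N) := by
  set S := eLpNorm (fun ξ : EuclideanSpace ℝ (Fin 2) => (1 + ‖ξ‖ ^ 2)⁻¹) 2 volume
  have hSfin : S ≠ ⊤ := memLp_one_add_norm_sq_inv.eLpNorm_ne_top
  have hNpos : (0 : ℝ) < N := by exact_mod_cast (Nat.zero_le M).trans_lt hMN
  have hθ : 0 ≤ (M : ℝ) / N := by positivity
  refine ⟨(3 ^ N ^ 2 * (S.toReal + 1)) ^ ((M : ℝ) / N), by positivity, fun f => ?_⟩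
  set E : ℕ → ENNReal := fun k => eLpNorm (omegaSchwartz^[k] f) ⊤ volume with hE
  have hEfin (k : ℕ) : E k ≠ ⊤ := ((omegaSchwartz^[k] f).eLpNorm_lt_top ⊤ volume).ne
  have hpow := pow_le_of_sq_le_nine_mul (a := fun k => (E k).toReal)
    (fun _ => ENNReal.toReal_nonneg) (fun k => by
      simpa only [hE, Function.iterate_succ_apply'] using
        toReal_eLpNorm_omegaSchwartz_sq_le (omegaSchwartz^[k] f)) hMN.le
  have hpow' : E M ^ N ≤ E 0 ^ (N - M) * (3 ^ N ^ 2 * E N) ^ M := by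
    have hM := hEfin M
    have h0 := hEfin 0
    have hN := hEfin N
    rw [← ENNReal.toReal_le_toReal (by finiteness) (by finiteness)]
    simpa using hpow
  have hroot : E M ≤ E 0 ^ (1 - (M : ℝ) / N) * (3 ^ N ^ 2 * E N) ^ ((M : ℝ) / N) := by
    rw [← ENNReal.rpow_le_rpow_iff hNpos, ENNReal.mul_rpow_of_nonneg _ _ hNpos.le,
      ← ENNReal.rpow_mul, ← ENNReal.rpow_mul, sub_mul, div_mul_cancel₀ _ hNpos.ne', one_mul,
      ← Nat.cast_sub hMN.le, ENNReal.rpow_natCast, ENNReal.rpow_natCast, ENNReal.rpow_natCast]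
    exact hpow'
  have hsob : E N ≤ S * (Finset.range (N + 1)).sup fun a =>
      eLpNorm (JD 2 (Omega^[a] ⇑f)) 2 volume := by
    refine (eLpNorm_top_le_mul_eLpNorm_JD _).trans ?_
    rw [coe_iterate_omegaSchwartz]
    gcongr
    exact Finset.le_sup (f := fun a => eLpNorm (JD 2 (Omega^[a] ⇑f)) 2 volume)
      (Finset.self_mem_range_succ N)
  have hconst : 3 ^ N ^ 2 * S ≤ ENNReal.ofReal (3 ^ N ^ 2 * (S.toReal + 1)) := by
    rw [ENNReal.ofReal_mul (by positivity), ENNReal.ofReal_pow (by norm_num)]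
    gcongr
    · simp
    · exact (ENNReal.le_ofReal_iff_toReal_le hSfin (by positivity)).2 (by linarith)
  have hEN : 3 ^ N ^ 2 * E N ≤ ENNReal.ofReal (3 ^ N ^ 2 * (S.toReal + 1)) *
      (Finset.range (N + 1)).sup fun a => eLpNorm (JD 2 (Omega^[a] ⇑f)) 2 volume :=
    (mul_le_mul_right hsob _).trans ((mul_assoc _ _ _).symm.trans_le (mul_le_mul_left hconst _))
  rw [← coe_iterate_omegaSchwartz, ← ENNReal.ofReal_rpow_of_nonneg (by positivity) hθ,
    mul_right_comm, ← ENNReal.mul_rpow_of_nonneg _ _ hθ, mul_comm]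
  exact hroot.trans (mul_le_mul_right (ENNReal.rpow_le_rpow hEN hθ) _)
end

section
/- Let N₀ > N ≥ 0 be integers, s > 0, and s₀ ≥ N₀·s/(N₀ - N). Then there is a constant C such that for every Schwartz function f on ℝ², ‖⟨D⟩^s Ω^N f‖_{L²} ≤ C·(‖⟨D⟩^{s₀} f‖_{L²} + ‖Ω^{N₀} f‖_{L²}), where Ω = x₁∂_{x₂} - x₂∂_{x₁} and ⟨D⟩^s is the Fourier multiplier with symbol (1+|ξ|²)^{s/2}. -/
open MeasureTheory
open scoped FourierTransform

open scoped LineDeriv SchwartzMap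

local notation "Plane" => EuclideanSpace ℝ (Fin 2)

/-- The rotation field `x₀ ∂₁ - x₁ ∂₀` acting on Schwartz functions. -/
noncomputable def rotationDeriv (f : 𝓢(Plane, ℂ)) : 𝓢(Plane, ℂ) :=
  SchwartzMap.smulLeftCLM ℂ (inner ℝ · (EuclideanSpace.single 0 1 : Plane))
      (∂_{(EuclideanSpace.single 1 1 : Plane)} f) -
    SchwartzMap.smulLeftCLM ℂ (inner ℝ · (EuclideanSpace.single 1 1 : Plane))
      (∂_{(EuclideanSpace.single 0 1 : Plane)} f)

/-- Multiplication of Schwartz functions by `(1 + ‖ξ‖²)^(σ/2)`. -/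
noncomputable def besselWeight (σ : ℝ) (f : 𝓢(Plane, ℂ)) : 𝓢(Plane, ℂ) :=
  SchwartzMap.smulLeftCLM ℂ (fun ξ : Plane => (1 + ‖ξ‖ ^ 2) ^ (σ / 2)) f

theorem besselWeight_apply (σ : ℝ) (f : 𝓢(Plane, ℂ)) (ξ : Plane) :
    besselWeight σ f ξ = (1 + ‖ξ‖ ^ 2) ^ (σ / 2) • f ξ :=
  SchwartzMap.smulLeftCLM_apply_apply
    (Function.hasTemperateGrowth_one_add_norm_sq_rpow Plane (σ / 2)) f ξ

theorem rotationDeriv_apply (f : 𝓢(Plane, ℂ)) (x : Plane) :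
    rotationDeriv f x = x 0 • fderiv ℝ f x (EuclideanSpace.single 1 1) -
      x 1 • fderiv ℝ f x (EuclideanSpace.single 0 1) := by
  have h (m : Plane) : (inner ℝ · m).HasTemperateGrowth := by fun_prop
  rw [rotationDeriv, sub_apply, SchwartzMap.smulLeftCLM_apply_apply (h _),
    SchwartzMap.smulLeftCLM_apply_apply (h _)]
  simp [SchwartzMap.lineDerivOp_apply_eq_fderiv, EuclideanSpace.inner_single_right]

theorem coe_rotationDeriv_iterate (n : ℕ) (f : 𝓢(Plane, ℂ)) :
    ⇑(rotationDeriv^[n] f) = Omega^[n] ⇑f := by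
  induction n with
  | zero => rfl
  | succ n ih =>
    rw [Function.iterate_succ_apply', Function.iterate_succ_apply', ← ih]
    funext x
    exact rotationDeriv_apply _ x

theorem lineDerivOp_smulLeftCLM_of_fderiv_eq_zero {w : Plane → ℝ} (hw : w.HasTemperateGrowth)
    {m : Plane} (h : ∀ x, fderiv ℝ w x m = 0) (f : 𝓢(Plane, ℂ)) :
    ∂_{m} (SchwartzMap.smulLeftCLM ℂ w f) = SchwartzMap.smulLeftCLM ℂ w (∂_{m} f) := by
  ext x
  have hd : DifferentiableAt ℝ w x := hw.1.differentiable (by simp) x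
  rw [SchwartzMap.lineDerivOp_apply_eq_fderiv, SchwartzMap.smulLeftCLM_apply hw,
    SchwartzMap.smulLeftCLM_apply_apply hw, SchwartzMap.lineDerivOp_apply_eq_fderiv,
    fderiv_fun_smul hd f.differentiableAt]
  simp [h]

theorem lineDerivOp_smulLeftCLM_inner {m v : Plane} (h : inner ℝ m v = 0) (f : 𝓢(Plane, ℂ)) :
    ∂_{m} (SchwartzMap.smulLeftCLM ℂ (inner ℝ · v) f) =
      SchwartzMap.smulLeftCLM ℂ (inner ℝ · v) (∂_{m} f) := by
  refine lineDerivOp_smulLeftCLM_of_fderiv_eq_zero (by fun_prop) (fun x => ?_) f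
  rw [fderiv_inner_apply ℝ differentiableAt_fun_id (differentiableAt_const v)]
  simp [h]

theorem rotationDeriv_besselWeight (σ : ℝ) (f : 𝓢(Plane, ℂ)) :
    rotationDeriv (besselWeight σ f) = besselWeight σ (rotationDeriv f) := by
  ext x
  have hw : HasFDerivAt (fun ξ : Plane => (1 + ‖ξ‖ ^ 2) ^ (σ / 2)) _ x :=
    ((hasStrictFDerivAt_norm_sq x).hasFDerivAt.const_add 1).rpow_const
      (Or.inl (by positivity))
  have hf : ⇑(besselWeight σ f) = fun ξ => (1 + ‖ξ‖ ^ 2) ^ (σ / 2) • f ξ :=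
    funext (besselWeight_apply σ f)
  rw [besselWeight_apply, rotationDeriv_apply, rotationDeriv_apply, hf,
    (hw.fun_smul f.differentiableAt.hasFDerivAt).fderiv]
  simp [EuclideanSpace.inner_single_right]
  ring

theorem inner_single_single_eq_zero {i j : Fin 2} (h : i ≠ j) :
    inner ℝ (EuclideanSpace.single i 1 : Plane) (EuclideanSpace.single j 1) = 0 := by
  simp [EuclideanSpace.inner_single_left, h]

theorem fourier_smulLeftCLM_lineDerivOp {m v : Plane} (h : inner ℝ m v = 0) (f : 𝓢(Plane, ℂ)) :
    𝓕 (SchwartzMap.smulLeftCLM ℂ (inner ℝ · m) (∂_{v} f)) =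
      -SchwartzMap.smulLeftCLM ℂ (inner ℝ · v) (∂_{m} (𝓕 f)) := by
  have hc : (2 * Real.pi * Complex.I : ℂ) ≠ 0 := by simp [Real.pi_ne_zero]
  have h₁ := SchwartzMap.lineDerivOp_fourier_eq (∂_{v} f) m
  rw [SchwartzMap.fourier_lineDerivOp_eq, LineDeriv.lineDerivOp_smul,
    lineDerivOp_smulLeftCLM_inner h, FourierTransform.fourier_smul, neg_smul,
    ← smul_neg] at h₁
  have h₂ := smul_right_injective _ hc h₁
  rw [h₂, neg_neg]

theorem fourier_rotationDeriv (f : 𝓢(Plane, ℂ)) :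
    𝓕 (rotationDeriv f) = rotationDeriv (𝓕 f) := by
  rw [rotationDeriv, sub_eq_add_neg, FourierTransform.fourier_add, FourierTransform.fourier_neg,
    fourier_smulLeftCLM_lineDerivOp (inner_single_single_eq_zero zero_ne_one),
    fourier_smulLeftCLM_lineDerivOp (inner_single_single_eq_zero one_ne_zero), rotationDeriv]
  abel

theorem fourier_rotationDeriv_iterate (n : ℕ) (f : 𝓢(Plane, ℂ)) :
    𝓕 (rotationDeriv^[n] f) = rotationDeriv^[n] (𝓕 f) :=
  (Function.Semiconj.iterate_right (f := fun g : 𝓢(Plane, ℂ) => 𝓕 g)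
    fourier_rotationDeriv n) f

theorem SchwartzMap.integrable_inner (f g : 𝓢(Plane, ℂ)) :
    Integrable (fun x => inner ℝ (f x) (g x)) :=
  (SchwartzMap.pairing (innerSL ℝ) f g).integrable

theorem SchwartzMap.integrable_norm_sq (f : 𝓢(Plane, ℂ)) :
    Integrable (fun x => ‖f x‖ ^ 2) := by
  simpa using f.integrable_inner f

theorem integral_inner_smulLeftCLM_lineDerivOp {m v : Plane} (h : inner ℝ v m = 0)
    (f g : 𝓢(Plane, ℂ)) :
    ∫ x, inner ℝ (f x) (SchwartzMap.smulLeftCLM ℂ (inner ℝ · m) (∂_{v} g) x) =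
      -∫ x, inner ℝ (SchwartzMap.smulLeftCLM ℂ (inner ℝ · m) (∂_{v} f) x) (g x) := by
  have hm : (inner ℝ · m).HasTemperateGrowth := by fun_prop
  have key := SchwartzMap.integral_bilinear_lineDerivOp_right_eq_neg_left (μ := volume)
    (SchwartzMap.smulLeftCLM ℂ (inner ℝ · m) f) g (innerSL ℝ) v
  rw [lineDerivOp_smulLeftCLM_inner h] at key
  refine Eq.trans (congrArg (integral volume) ?_) key
  funext x
  simp only [SchwartzMap.smulLeftCLM_apply_apply hm, real_inner_smul_right]
  exact (real_inner_smul_left _ _ _).symm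

theorem integral_inner_rotationDeriv (f g : 𝓢(Plane, ℂ)) :
    ∫ x, inner ℝ (f x) (rotationDeriv g x) = -∫ x, inner ℝ (rotationDeriv f x) (g x) := by
  simp only [rotationDeriv, sub_apply, inner_sub_left, inner_sub_right]
  rw [integral_sub (f.integrable_inner _) (f.integrable_inner _),
    integral_sub (SchwartzMap.integrable_inner _ g) (SchwartzMap.integrable_inner _ g),
    integral_inner_smulLeftCLM_lineDerivOp (inner_single_single_eq_zero one_ne_zero),
    integral_inner_smulLeftCLM_lineDerivOp (inner_single_single_eq_zero zero_ne_one)]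
  ring

theorem inner_besselWeight_besselWeight {a b c d : ℝ} (h : a + b = c + d) (f g : 𝓢(Plane, ℂ))
    (x : Plane) :
    inner ℝ (besselWeight a f x) (besselWeight b g x) =
      inner ℝ (besselWeight c f x) (besselWeight d g x) := by
  have hx : 0 < 1 + ‖x‖ ^ 2 := by positivity
  simp only [besselWeight_apply, real_inner_smul_left, real_inner_smul_right]
  rw [← mul_assoc, ← mul_assoc, ← Real.rpow_add hx, ← Real.rpow_add hx, ← add_div, ← add_div, add_comm b, add_comm d, h]

theorem two_mul_integral_norm_sq_besselWeight_rotationDeriv_le {a b c : ℝ} (h : b + b = a + c)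
    (f : 𝓢(Plane, ℂ)) :
    2 * ∫ x, ‖besselWeight b (rotationDeriv f) x‖ ^ 2 ≤
      (∫ x, ‖besselWeight a f x‖ ^ 2) +
        ∫ x, ‖besselWeight c (rotationDeriv (rotationDeriv f)) x‖ ^ 2 := by
  have h₁ : ∫ x, ‖besselWeight b (rotationDeriv f) x‖ ^ 2 =
      -∫ x, inner ℝ (besselWeight c (rotationDeriv (rotationDeriv f)) x) (besselWeight a f x) := by
    simp_rw [← real_inner_self_eq_norm_sq]
    conv_lhs => enter [2, x, 3]; rw [← rotationDeriv_besselWeight]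
    rw [integral_inner_rotationDeriv, rotationDeriv_besselWeight]
    simp_rw [inner_besselWeight_besselWeight (h.trans (add_comm a c))]
  rw [h₁, ← integral_neg, ← integral_const_mul,
    ← integral_add (SchwartzMap.integrable_norm_sq _) (SchwartzMap.integrable_norm_sq _)]
  refine integral_mono ((SchwartzMap.integrable_inner _ _).neg.const_mul 2)
    ((SchwartzMap.integrable_norm_sq _).add (SchwartzMap.integrable_norm_sq _)) fun x => ?_
  have := norm_add_sq_real (besselWeight c (rotationDeriv (rotationDeriv f)) x)
    (besselWeight a f x)
  have := sq_nonneg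
    ‖besselWeight c (rotationDeriv (rotationDeriv f)) x + besselWeight a f x‖
  simp only
  linarith

theorem le_max_of_two_mul_le_add {b : ℕ → ℝ} {m : ℕ}
    (hb : ∀ j, j + 2 ≤ m → 2 * b (j + 1) ≤ b j + b (j + 2)) {n : ℕ} (hn : n ≤ m) :
    b n ≤ max (b 0) (b m) := by
  have step (j : ℕ) (hj : j + 1 ≤ m) : b j ≤ max (b 0) (b (j + 1)) := by
    induction j with
    | zero => exact le_max_left _ _
    | succ j ih =>
      have h₁ := hb j hj
      rcases le_max_iff.mp (ih (by omega)) with h₂ | h₂ <;> rw [le_max_iff]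
      · by_contra! h₃
        linarith
      · exact Or.inr (by linarith)
  induction m, hn using Nat.le_induction with
  | base => exact le_max_right _ _
  | succ k hk ih =>
    exact (ih (fun j hj => hb j (by omega)) (fun j hj => step j (by omega))).trans
      (max_le (le_max_left _ _) (step k le_rfl))

theorem integral_norm_sq_besselWeight_mono {s t : ℝ} (h : s ≤ t) (f : 𝓢(Plane, ℂ)) :
    ∫ x, ‖besselWeight s f x‖ ^ 2 ≤ ∫ x, ‖besselWeight t f x‖ ^ 2 := by
  refine integral_mono (SchwartzMap.integrable_norm_sq _) (SchwartzMap.integrable_norm_sq _)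
    fun x => ?_
  have hx : 1 ≤ 1 + ‖x‖ ^ 2 := by simp
  simp only [besselWeight_apply, norm_smul, Real.norm_eq_abs]
  rw [abs_of_nonneg (by positivity), abs_of_nonneg (by positivity)]
  gcongr

theorem integral_norm_sq_besselWeight_rotationDeriv_iterate_le {N N₀ : ℕ} (h : N < N₀)
    {s s₀ : ℝ} (hs₀ : (N₀ : ℝ) * s / ((N₀ : ℝ) - (N : ℝ)) ≤ s₀) (f : 𝓢(Plane, ℂ)) :
    ∫ x, ‖besselWeight s (rotationDeriv^[N] f) x‖ ^ 2 ≤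
      max (∫ x, ‖besselWeight s₀ f x‖ ^ 2) (∫ x, ‖rotationDeriv^[N₀] f x‖ ^ 2) := by
  have hN : (N : ℝ) < N₀ := by exact_mod_cast h
  have hN₀ : (0 : ℝ) < N₀ := (Nat.cast_nonneg N).trans_lt hN
  let σ : ℕ → ℝ := fun j => s₀ * (N₀ - j) / N₀
  have hσ : s ≤ σ N := by
    rw [div_le_iff₀ (sub_pos.mpr hN)] at hs₀
    rw [le_div_iff₀ hN₀]
    linarith
  have hmax := le_max_of_two_mul_le_add (m := N₀)
    (b := fun j => ∫ x, ‖besselWeight (σ j) (rotationDeriv^[j] f) x‖ ^ 2) (fun j _ => by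
      simp only [Function.iterate_succ_apply']
      refine two_mul_integral_norm_sq_besselWeight_rotationDeriv_le ?_ _
      simp only [σ]
      push_cast
      ring) h.le
  refine (integral_norm_sq_besselWeight_mono hσ _).trans (hmax.trans_eq ?_)
  have h₀ : σ 0 = s₀ := by simp [σ, hN₀.ne']
  have h₁ : σ N₀ = 0 := by simp [σ]
  simp [h₀, h₁, besselWeight_apply]

theorem SchwartzMap.eLpNorm_two_eq (f : 𝓢(Plane, ℂ)) :
    eLpNorm f 2 volume = ENNReal.ofReal (√(∫ x, ‖f x‖ ^ 2)) := by
  rw [(f.memLp 2 volume).eLpNorm_eq_integral_rpow_norm (by simp) (by simp)]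
  simp [Real.sqrt_eq_rpow]

theorem JD_coe (s : ℝ) (f : 𝓢(Plane, ℂ)) : JD s ⇑f = ⇑(𝓕⁻ (besselWeight s (𝓕 f)) : 𝓢(Plane, ℂ)) := by
  rw [SchwartzMap.fourierInv_coe, JD]
  congr 1
  funext ξ
  rw [besselWeight_apply, Complex.real_smul, SchwartzMap.fourier_coe]

theorem eLpNorm_JD (s : ℝ) (f : 𝓢(Plane, ℂ)) :
    eLpNorm (JD s ⇑f) 2 volume = ENNReal.ofReal (√(∫ x, ‖besselWeight s (𝓕 f) x‖ ^ 2)) := by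
  rw [JD_coe, SchwartzMap.eLpNorm_two_eq, ← SchwartzMap.integral_norm_sq_fourier,
    FourierTransform.fourier_fourierInv_eq]

theorem stmt_19 (N N₀ : ℕ) (h : N < N₀) (s s₀ : ℝ) (hs : 0 < s)
    (hs₀ : (N₀ : ℝ) * s / ((N₀ : ℝ) - (N : ℝ)) ≤ s₀) :
    ∃ C : ℝ, 0 < C ∧ ∀ f : SchwartzMap (EuclideanSpace ℝ (Fin 2)) ℂ,
      eLpNorm (JD s (Omega^[N] ⇑f)) 2 volume ≤
        ENNReal.ofReal C *
          (eLpNorm (JD s₀ ⇑f) 2 volume + eLpNorm (Omega^[N₀] ⇑f) 2 volume) := by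
  refine ⟨1, one_pos, fun f => ?_⟩
  rw [← coe_rotationDeriv_iterate, ← coe_rotationDeriv_iterate, eLpNorm_JD, eLpNorm_JD,
    SchwartzMap.eLpNorm_two_eq, ← SchwartzMap.integral_norm_sq_fourier (rotationDeriv^[N₀] f),
    fourier_rotationDeriv_iterate, fourier_rotationDeriv_iterate, ENNReal.ofReal_one, one_mul,
    ← ENNReal.ofReal_add (by positivity) (by positivity)]
  refine ENNReal.ofReal_le_ofReal ((Real.sqrt_le_sqrt
    (integral_norm_sq_besselWeight_rotationDeriv_iterate_le h hs₀ (𝓕 f))).trans ?_)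
  rw [Monotone.map_max fun _ _ => Real.sqrt_le_sqrt]
  exact max_le_add_of_nonneg (by positivity) (by positivity)
end
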